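/- Let A and B be homogeneous sets with α_A(r) ∼ α_A(x*,r) and α_B(r) ∼ α_B(y*,r) for some x* ∈ A and y* ∈ B. Suppose that for some r₀ < 1, the supremum over all r, r' with r' < r₀·r < r < r₀ of |(α_A(r) log r − α_A(r') log r')/(α_B(r) log r − α_B(r') log r')| is strictly less than 1, and suppose in addition that A is uniformly disconnected. Then A can be bilipschitz embedded into B. -/

import Mathlib

open scoped ENNReal

noncomputable section

open Filter MeasureTheory

/-- A compact set `A` is *homogeneous* with respect to the Borel probability measure `μ`
supported on `A` and constants `lam ≥ 1`, `kappa ∈ (0,1)`, `1 < del ≤ Del`. -/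
structure IsHomog {X : Type*} [MetricSpace X] [MeasurableSpace X]
    (A : Set X) (μ : Measure X) (lam kappa del Del : ℝ) : Prop where
  compact : IsCompact A
  diam_pos : 0 < Metric.diam A
  prob : IsProbabilityMeasure μ
  supp_null : μ Aᶜ = 0
  supp_pos : ∀ x ∈ A, ∀ r : ℝ, 0 < r → 0 < μ (Metric.closedBall x r)
  one_le_lam : 1 ≤ lam
  ratio_le : ∀ x₁ ∈ A, ∀ x₂ ∈ A, ∀ r : ℝ, 0 < r → r ≤ Metric.diam A →
    (μ (Metric.closedBall x₁ r)).toReal ≤ lam * (μ (Metric.closedBall x₂ r)).toReal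
  kappa_pos : 0 < kappa
  kappa_lt_one : kappa < 1
  one_lt_del : 1 < del
  del_le_Del : del ≤ Del
  scale_lower : ∀ x ∈ A, ∀ r : ℝ, 0 < r → r ≤ Metric.diam A →
    del * (μ (Metric.closedBall x (kappa * r))).toReal ≤ (μ (Metric.closedBall x r)).toReal
  scale_upper : ∀ x ∈ A, ∀ r : ℝ, 0 < r → r ≤ Metric.diam A →
    (μ (Metric.closedBall x r)).toReal ≤ Del * (μ (Metric.closedBall x (kappa * r))).toReal

/-- `alphaPt μ x r = log μ(B(x,r)) / log r`. -/
def alphaPt {X : Type*} [MetricSpace X] [MeasurableSpace X]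
    (μ : Measure X) (x : X) (r : ℝ) : ℝ :=
  Real.log (μ (Metric.closedBall x r)).toReal / Real.log r

/-- `g ∼ h` : `|h r - g r| = O(1/|log r|)` as `r → 0⁺`. -/
def EquivNearZero (g h : ℝ → ℝ) : Prop :=
  ∃ C : ℝ, 0 < C ∧ ∃ δ : ℝ, 0 < δ ∧ ∀ r : ℝ, 0 < r → r < δ → |h r - g r| ≤ C / |Real.log r|

/-- `g` is a representative of the equivalence class `[α_A(x,·)]` of the homogeneous set `A`. -/
def IsAlphaRep {X : Type*} [MetricSpace X] [MeasurableSpace X]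
    (A : Set X) (μ : Measure X) (g : ℝ → ℝ) : Prop :=
  ∃ x ∈ A, EquivNearZero g (fun r => alphaPt μ x r)

/-- `χ(A,B)` computed from representatives `g` of `[α_A]` and `h` of `[α_B]`. -/
def chiFun (g h : ℝ → ℝ) : ℝ :=
  Filter.limsup (fun r => |Real.log (g r / h r)|) (nhdsWithin (0 : ℝ) (Set.Ioi 0))

/-- `N(A,r)`: the smallest number of closed balls of radius `r` needed to cover `A`. -/
def coverNum {X : Type*} [MetricSpace X] (A : Set X) (r : ℝ) : ℕ :=
  sInf {m : ℕ | ∃ s : Finset X, s.card = m ∧ A ⊆ ⋃ x ∈ s, Metric.closedBall x r}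

/-- Lower box-counting dimension. -/
def lowerBoxDim {X : Type*} [MetricSpace X] (A : Set X) : ℝ :=
  Filter.liminf (fun r : ℝ => Real.log (coverNum A r : ℝ) / (-Real.log r))
    (nhdsWithin (0 : ℝ) (Set.Ioi 0))

/-- Upper box-counting dimension. -/
def upperBoxDim {X : Type*} [MetricSpace X] (A : Set X) : ℝ :=
  Filter.limsup (fun r : ℝ => Real.log (coverNum A r : ℝ) / (-Real.log r))
    (nhdsWithin (0 : ℝ) (Set.Ioi 0))

/-- Radius-based packing premeasure. -/
def packPre {X : Type*} [MetricSpace X] (A : Set X) (s : ℝ) : ℝ≥0∞ :=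
  ⨅ (δ : ℝ) (_ : 0 < δ),
    ⨆ (m : ℕ) (x : Fin m → X) (ρ : Fin m → ℝ) (_ : ∀ i, x i ∈ A)
      (_ : ∀ i, 0 < ρ i ∧ ρ i ≤ δ)
      (_ : ∀ i j, i ≠ j →
        Disjoint (Metric.closedBall (x i) (ρ i)) (Metric.closedBall (x j) (ρ j))),
      ∑ i, ENNReal.ofReal (ρ i ^ s)

/-- Radius-based packing measure. -/
def packMeasure {X : Type*} [MetricSpace X] (A : Set X) (s : ℝ) : ℝ≥0∞ :=
  ⨅ (F : ℕ → Set X) (_ : A ⊆ ⋃ m, F m), ∑' m, packPre (F m) s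

/-- Radius-based packing dimension. -/
def packDim {X : Type*} [MetricSpace X] (A : Set X) : ℝ :=
  sInf {s : ℝ | 0 ≤ s ∧ packMeasure A s = 0}

/-- Distance between two sets, valued in `ℝ≥0∞`. -/
def setDistE {X : Type*} [MetricSpace X] (E F : Set X) : ℝ≥0∞ :=
  ⨅ (a : X) (_ : a ∈ E) (b : X) (_ : b ∈ F), edist a b

/-- Uniformly disconnected set. -/
def UnifDisconn {X : Type*} [MetricSpace X] (A : Set X) : Prop :=
  ∃ C : ℝ, 1 < C ∧ ∃ rstar : ℝ, 0 < rstar ∧ ∀ x ∈ A, ∀ r : ℝ, 0 < r → r < rstar →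
    ∃ E : Set X, E ⊆ A ∧ A ∩ Metric.closedBall x r ⊆ E ∧
      E ⊆ Metric.closedBall x (C * r) ∧ ENNReal.ofReal r < setDistE E (A \ E)

/-- `A` can be bilipschitz embedded into `B`. -/
def BilipEmbed {X Y : Type*} [MetricSpace X] [MetricSpace Y] (A : Set X) (B : Set Y) : Prop :=
  ∃ (f : X → Y) (L : ℝ), 1 ≤ L ∧ Set.MapsTo f A B ∧ Set.InjOn f A ∧
    ∀ x₁ ∈ A, ∀ x₂ ∈ A,
      dist x₁ x₂ / L ≤ dist (f x₁) (f x₂) ∧ dist (f x₁) (f x₂) ≤ L * dist x₁ x₂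

/-- `A` and `B` are bilipschitz equivalent. -/
def BilipEquivSets {X Y : Type*} [MetricSpace X] [MetricSpace Y] (A : Set X) (B : Set Y) :
    Prop :=
  ∃ (f : X → Y) (L : ℝ), 1 ≤ L ∧ Set.BijOn f A B ∧
    ∀ x₁ ∈ A, ∀ x₂ ∈ A,
      dist x₁ x₂ / L ≤ dist (f x₁) (f x₂) ∧ dist (f x₁) (f x₂) ≤ L * dist x₁ x₂

/-- `A` and `B` are quasi-Lipschitz equivalent. -/
def QuasiLipEquiv {X Y : Type*} [MetricSpace X] [MetricSpace Y] (A : Set X) (B : Set Y) : Prop :=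
  ∃ f : X → Y, Set.BijOn f A B ∧
    ∀ ε : ℝ, 0 < ε → ∃ δ : ℝ, 0 < δ ∧ ∀ x₁ ∈ A, ∀ x₂ ∈ A,
      0 < dist x₁ x₂ → dist x₁ x₂ < δ →
      |Real.log (dist (f x₁) (f x₂)) / Real.log (dist x₁ x₂) - 1| < ε

/-- Ahlfors–David `s`-regular set. -/
def IsADRegular {X : Type*} [MetricSpace X] [MeasurableSpace X] (A : Set X) (s : ℝ) : Prop :=
  IsCompact A ∧ 0 < Metric.diam A ∧
    ∃ (μ : Measure X) (c : ℝ), 1 ≤ c ∧ μ Aᶜ = 0 ∧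
      ∀ x ∈ A, ∀ r : ℝ, 0 < r → r ≤ Metric.diam A →
        ENNReal.ofReal (c⁻¹ * r ^ s) ≤ μ (Metric.closedBall x r) ∧
          μ (Metric.closedBall x r) ≤ ENNReal.ofReal (c * r ^ s)

/-- `n₁ ⋯ n_k` (with `0`-based indexing of the sequence `n`). -/
def prodN (n : ℕ → ℕ) (k : ℕ) : ℕ := ∏ i ∈ Finset.range k, n i

/-- `c₁ ⋯ c_k` (with `0`-based indexing of the sequence `c`). -/
def prodC (c : ℕ → ℝ) (k : ℕ) : ℝ := ∏ i ∈ Finset.range k, c i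

/-- Admissible word for the branching sequence `n`. -/
def AdmWord (n : ℕ → ℕ) (w : List ℕ) : Prop := ∀ i : Fin w.length, w.get i < n i.val

/-- A Moran structure on `J ⊆ ℝ^d` with branching numbers `n` and ratios `c`:
`Jw w` is the basic set indexed by the word `w`. -/
structure IsMoranSystem {d : ℕ} (J : Set (EuclideanSpace ℝ (Fin d))) (n : ℕ → ℕ)
    (c : ℕ → ℝ) (Jw : List ℕ → Set (EuclideanSpace ℝ (Fin d))) : Prop where
  compact : IsCompact J
  int_nonempty : (interior J).Nonempty
  two_le_n : ∀ k, 2 ≤ n k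
  c_pos : ∀ k, 0 < c k
  c_lt_one : ∀ k, c k < 1
  c_inf_pos : ∃ c₀ : ℝ, 0 < c₀ ∧ ∀ k, c₀ ≤ c k
  root : Jw [] = J
  subset : ∀ w : List ℕ, AdmWord n w → ∀ i : ℕ, i < n w.length → Jw (w ++ [i]) ⊆ Jw w
  similar : ∀ w : List ℕ, AdmWord n w → ∀ i : ℕ, i < n w.length →
    ∃ S : EuclideanSpace ℝ (Fin d) → EuclideanSpace ℝ (Fin d),
      (∀ x y, dist (S x) (S y) = c w.length * dist x y) ∧ Jw (w ++ [i]) = S '' Jw w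
  disj_int : ∀ w : List ℕ, AdmWord n w → ∀ i : ℕ, i < n w.length → ∀ j : ℕ, j < n w.length →
    i ≠ j → Disjoint (interior (Jw (w ++ [i]))) (interior (Jw (w ++ [j])))

/-- The Moran set determined by the family `Jw`. -/
def moranSet {d : ℕ} (n : ℕ → ℕ) (Jw : List ℕ → Set (EuclideanSpace ℝ (Fin d))) :
    Set (EuclideanSpace ℝ (Fin d)) :=
  ⋂ k : ℕ, ⋃ (w : List ℕ) (_ : w.length = k ∧ AdmWord n w), Jw w

/-- The index `k` such that `(c₁⋯c_k)·D < r ≤ (c₁⋯c_{k-1})·D`. -/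
def levelOf (c : ℕ → ℝ) (D r : ℝ) : ℕ := sInf {k : ℕ | prodC c k * D < r}

/-- `Φ(r) = n₁⋯n_k` whenever `(c₁⋯c_k)·D < r ≤ (c₁⋯c_{k-1})·D`, where `D = |J|`. -/
def Phi (n : ℕ → ℕ) (c : ℕ → ℝ) (D r : ℝ) : ℕ := prodN n (levelOf c D r)

namespace IsHomog

variable {X : Type*} [MetricSpace X] [MeasurableSpace X]
  {A : Set X} {μ : Measure X} {lam kappa del Del : ℝ}

lemma real_closedBall_pos (h : IsHomog A μ lam kappa del Del) {x : X} (hx : x ∈ A) {r : ℝ}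
    (hr : 0 < r) : 0 < μ.real (Metric.closedBall x r) := by
  have := h.prob
  exact ENNReal.toReal_pos (h.supp_pos x hx r hr).ne' (measure_ne_top _ _)

lemma real_closedBall_mono (h : IsHomog A μ lam kappa del Del) (x : X) {r s : ℝ}
    (hrs : r ≤ s) : μ.real (Metric.closedBall x r) ≤ μ.real (Metric.closedBall x s) := by
  have := h.prob
  exact measureReal_mono (Metric.closedBall_subset_closedBall hrs)

lemma real_closedBall_le_one (h : IsHomog A μ lam kappa del Del) (x : X) (r : ℝ) :
    μ.real (Metric.closedBall x r) ≤ 1 := by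
  have := h.prob
  exact measureReal_le_one

lemma real_closedBall_eq_one [BorelSpace X] (h : IsHomog A μ lam kappa del Del)
    {x : X} (hx : x ∈ A) {r : ℝ}
    (hr : Metric.diam A ≤ r) : μ.real (Metric.closedBall x r) = 1 := by
  have := h.prob
  have hsub : A ⊆ Metric.closedBall x r := fun y hy =>
    (Metric.dist_le_diam_of_mem h.compact.isBounded hy hx).trans hr
  have hnull : μ (Metric.closedBall x r)ᶜ = 0 :=
    measure_mono_null (Set.compl_subset_compl.2 hsub) h.supp_null
  have := (prob_compl_eq_zero_iff Metric.isClosed_closedBall.measurableSet).1 hnull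
  simp [measureReal_def, this]

lemma real_closedBall_le_mul [BorelSpace X] (h : IsHomog A μ lam kappa del Del)
    {x y : X} (hx : x ∈ A)
    (hy : y ∈ A) {r : ℝ} (hr : 0 < r) :
    μ.real (Metric.closedBall x r) ≤ lam * μ.real (Metric.closedBall y r) := by
  rcases le_total r (Metric.diam A) with hd | hd
  · exact h.ratio_le x hx y hy r hr hd
  · rw [h.real_closedBall_eq_one hx hd, h.real_closedBall_eq_one hy hd, mul_one]
    exact h.one_le_lam

lemma Del_pos (h : IsHomog A μ lam kappa del Del) : 0 < Del := by
  linarith [h.one_lt_del, h.del_le_Del]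

lemma real_closedBall_le_Del_mul [BorelSpace X] (h : IsHomog A μ lam kappa del Del)
    {x : X} (hx : x ∈ A)
    {r : ℝ} (hr : 0 < r) :
    μ.real (Metric.closedBall x r) ≤ Del * μ.real (Metric.closedBall x (kappa * r)) := by
  rcases le_total r (Metric.diam A) with hd | hd
  · exact h.scale_upper x hx r hr hd
  · rw [h.real_closedBall_eq_one hx hd, ← h.real_closedBall_eq_one hx le_rfl]
    refine (h.scale_upper x hx _ h.diam_pos le_rfl).trans ?_
    exact mul_le_mul_of_nonneg_left
      (h.real_closedBall_mono x (mul_le_mul_of_nonneg_left hd h.kappa_pos.le)) h.Del_pos.le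

lemma real_closedBall_le_Del_pow_mul [BorelSpace X] (h : IsHomog A μ lam kappa del Del)
    {x : X} (hx : x ∈ A)
    {r : ℝ} (hr : 0 < r) (n : ℕ) :
    μ.real (Metric.closedBall x r) ≤ Del ^ n * μ.real (Metric.closedBall x (kappa ^ n * r)) := by
  induction n with
  | zero => simp
  | succ n ih =>
    refine ih.trans ?_
    rw [pow_succ, mul_assoc, pow_succ', mul_assoc]
    exact mul_le_mul_of_nonneg_left
      (h.real_closedBall_le_Del_mul hx (mul_pos (pow_pos h.kappa_pos n) hr))
      (pow_pos h.Del_pos n).le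

lemma del_pow_mul_real_closedBall_le (h : IsHomog A μ lam kappa del Del) {x : X} (hx : x ∈ A)
    {r : ℝ} (hr : 0 < r) (hd : r ≤ Metric.diam A) (n : ℕ) :
    del ^ n * μ.real (Metric.closedBall x (kappa ^ n * r)) ≤ μ.real (Metric.closedBall x r) := by
  induction n with
  | zero => simp
  | succ n ih =>
    refine le_trans ?_ ih
    rw [pow_succ, mul_assoc, pow_succ' kappa, mul_assoc]
    refine mul_le_mul_of_nonneg_left
      (h.scale_lower x hx _ (mul_pos (pow_pos h.kappa_pos n) hr) ?_)
      (pow_pos (zero_lt_one.trans h.one_lt_del) n).le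
    calc kappa ^ n * r ≤ 1 * r := by
          gcongr
          exact pow_le_one₀ h.kappa_pos.le h.kappa_lt_one.le
      _ ≤ _ := by simpa using hd

lemma exists_doubling [BorelSpace X] (h : IsHomog A μ lam kappa del Del)
    {c : ℝ} (hc : 0 < c) :
    ∃ K : ℝ, 0 < K ∧ ∀ x ∈ A, ∀ r : ℝ, 0 < r →
      μ.real (Metric.closedBall x (c * r)) ≤ K * μ.real (Metric.closedBall x r) := by
  obtain ⟨n, hn⟩ := exists_pow_lt_of_lt_one (inv_pos.2 hc) h.kappa_lt_one
  refine ⟨Del ^ n, pow_pos h.Del_pos n, fun x hx r hr => ?_⟩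
  refine (h.real_closedBall_le_Del_pow_mul hx (mul_pos hc hr) n).trans ?_
  refine mul_le_mul_of_nonneg_left (h.real_closedBall_mono x ?_) (pow_pos h.Del_pos n).le
  calc kappa ^ n * (c * r) = kappa ^ n * c * r := by ring
    _ ≤ c⁻¹ * c * r := by gcongr
    _ = r := by field_simp

/-- Measures of concentric balls decay uniformly in the ratio of the radii. -/
lemma exists_log_sub_log_ge (h : IsHomog A μ lam kappa del Del) {x : X} (hx : x ∈ A)
    {D : ℝ} (hD : 0 < D) (T : ℝ) :
    ∃ ρ₀ : ℝ, 0 < ρ₀ ∧ ∀ ρ : ℝ, 0 < ρ → ρ ≤ ρ₀ → ∀ r : ℝ, 0 < r → r ≤ D →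
      T ≤ Real.log (μ.real (Metric.closedBall x r)) -
        Real.log (μ.real (Metric.closedBall x (ρ * r))) := by
  obtain ⟨n, hn⟩ := pow_unbounded_of_one_lt (Real.exp T) h.one_lt_del
  have hdiam := h.diam_pos
  set c : ℝ := min 1 (Metric.diam A / D) with hc
  have hcpos : 0 < c := lt_min one_pos (div_pos hdiam hD)
  have hκ := pow_pos h.kappa_pos n
  refine ⟨kappa ^ n * c, mul_pos hκ hcpos, fun ρ hρ hρ₀ r hr hrD => ?_⟩
  have h1 : c * r ≤ r := by
    have : c ≤ 1 := min_le_left _ _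
    nlinarith
  have h2 : c * r ≤ Metric.diam A := by
    have : c ≤ Metric.diam A / D := min_le_right _ _
    calc c * r ≤ Metric.diam A / D * D := by gcongr
      _ = _ := by field_simp
  have h3 := h.del_pow_mul_real_closedBall_le hx (mul_pos hcpos hr) h2 n
  have h4 : ρ * r ≤ kappa ^ n * (c * r) := by
    rw [← mul_assoc]; gcongr
  have p1 := h.real_closedBall_pos hx (mul_pos hρ hr)
  have h5 : Real.exp T * μ.real (Metric.closedBall x (ρ * r)) ≤ μ.real (Metric.closedBall x r) :=
    calc _ ≤ del ^ n * μ.real (Metric.closedBall x (kappa ^ n * (c * r))) :=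
          mul_le_mul hn.le (h.real_closedBall_mono x h4) p1.le ((Real.exp_pos T).le.trans hn.le)
      _ ≤ _ := h3.trans (h.real_closedBall_mono x h1)
  have h6 := Real.log_le_log (mul_pos (Real.exp_pos T) p1) h5
  rw [Real.log_mul (Real.exp_pos T).ne' p1.ne', Real.log_exp] at h6
  linarith

/-- Upper bound for the cardinality of a separated set in a ball. -/
lemma exists_card_mul_le [BorelSpace X] (h : IsHomog A μ lam kappa del Del)
    {x₀ : X} (hx₀ : x₀ ∈ A)
    {C : ℝ} (hC : 0 < C) :
    ∃ K : ℝ, 0 < K ∧ ∀ x ∈ A, ∀ r s : ℝ, 0 < s → s ≤ r → ∀ t : Finset X,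
      (∀ z ∈ t, z ∈ A ∧ dist z x ≤ C * r) → (∀ z ∈ t, ∀ w ∈ t, z ≠ w → s < dist z w) →
      (t.card : ℝ) * μ.real (Metric.closedBall x₀ s) ≤
        K * μ.real (Metric.closedBall x₀ r) := by
  have := h.prob
  obtain ⟨K₁, hK₁, H₁⟩ := h.exists_doubling (c := C + 1) (by linarith)
  obtain ⟨K₂, hK₂, H₂⟩ := h.exists_doubling (c := 2) (by norm_num)
  have hlam : 0 < lam := zero_lt_one.trans_le h.one_le_lam
  refine ⟨lam * K₂ * (K₁ * lam), by positivity, fun x hx r s hs hsr t ht hsep => ?_⟩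
  have hdisj : Set.PairwiseDisjoint (t : Set X) (fun z => Metric.closedBall z (s / 2)) := by
    intro z hz w hw hzw
    refine Metric.closedBall_disjoint_closedBall ?_
    simpa using hsep z hz w hw hzw
  have hsum : ∑ z ∈ t, μ.real (Metric.closedBall z (s / 2)) ≤
      μ.real (Metric.closedBall x ((C + 1) * r)) := by
    rw [← measureReal_biUnion_finset hdisj (fun z _ => Metric.isClosed_closedBall.measurableSet)]
    refine measureReal_mono (Set.iUnion₂_subset fun z hz => ?_)
    refine Metric.closedBall_subset_closedBall' ?_
    have := (ht z hz).2
    nlinarith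
  have hlow : ∀ z ∈ t, μ.real (Metric.closedBall x₀ s) ≤
      lam * K₂ * μ.real (Metric.closedBall z (s / 2)) := by
    intro z hz
    have h1 := h.real_closedBall_le_mul hx₀ (ht z hz).1 hs
    have h2 := H₂ z (ht z hz).1 (s / 2) (by positivity)
    rw [mul_div_cancel₀ s (two_ne_zero)] at h2
    calc _ ≤ _ := h1
      _ ≤ lam * (K₂ * μ.real (Metric.closedBall z (s / 2))) := by gcongr
      _ = _ := by ring
  have hr : 0 < r := hs.trans_le hsr
  calc (t.card : ℝ) * μ.real (Metric.closedBall x₀ s)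
      = ∑ z ∈ t, μ.real (Metric.closedBall x₀ s) := by simp
    _ ≤ ∑ z ∈ t, lam * K₂ * μ.real (Metric.closedBall z (s / 2)) := Finset.sum_le_sum hlow
    _ = lam * K₂ * ∑ z ∈ t, μ.real (Metric.closedBall z (s / 2)) := by rw [Finset.mul_sum]
    _ ≤ lam * K₂ * (K₁ * (lam * μ.real (Metric.closedBall x₀ r))) := by
        gcongr
        refine hsum.trans ((H₁ x hx r hr).trans ?_)
        gcongr
        exact h.real_closedBall_le_mul hx hx₀ hr
    _ = _ := by ring

/-- Every ball contains a large separated set. -/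
lemma exists_separated [BorelSpace X] (h : IsHomog A μ lam kappa del Del)
    {x₀ : X} (hx₀ : x₀ ∈ A) :
    ∃ K : ℝ, 0 < K ∧ ∀ x ∈ A, ∀ r s : ℝ, 0 < r → 0 < s → ∀ m : ℕ,
      (m : ℝ) * (K * μ.real (Metric.closedBall x₀ s)) ≤ μ.real (Metric.closedBall x₀ r) →
      ∃ P : Finset X, P.card = m ∧ (∀ z ∈ P, z ∈ A ∧ dist z x ≤ r) ∧
        ∀ z ∈ P, ∀ w ∈ P, z ≠ w → 4 * s < dist z w := by
  classical
  have := h.prob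
  obtain ⟨K, hK, H⟩ := h.exists_doubling (c := 4) (by norm_num)
  have hlam : 0 < lam := zero_lt_one.trans_le h.one_le_lam
  refine ⟨lam * (K * lam), by positivity, fun x hx r s hr hs m => ?_⟩
  set W := μ.real (Metric.closedBall x₀ s) with hW
  have hWpos : 0 < W := h.real_closedBall_pos hx₀ hs
  induction m with
  | zero => intro _; exact ⟨∅, by simp⟩
  | succ m ih =>
    intro hm
    push_cast at hm
    have hpos : 0 < lam * (K * lam) * W := by positivity
    obtain ⟨P, hPc, hPA, hPs⟩ := ih (by linarith)
    have hlt : μ.real (⋃ z ∈ P, Metric.closedBall z (4 * s)) < μ.real (Metric.closedBall x r) := by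
      have h1 : μ.real (⋃ z ∈ P, Metric.closedBall z (4 * s)) ≤ (m : ℝ) * (K * lam * W) := by
        refine (measureReal_biUnion_finset_le P _).trans ?_
        rw [← hPc, ← nsmul_eq_mul]
        refine Finset.sum_le_card_nsmul _ _ _ fun z hz => ?_
        rw [mul_assoc]
        refine (H z (hPA z hz).1 s hs).trans ?_
        gcongr
        exact h.real_closedBall_le_mul (hPA z hz).1 hx₀ hs
      have h2 := h.real_closedBall_le_mul hx₀ hx hr
      have h3 : lam * ((m : ℝ) * (K * lam * W)) < lam * μ.real (Metric.closedBall x r) := by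
        nlinarith
      exact h1.trans_lt (lt_of_mul_lt_mul_left h3 hlam.le)
    obtain ⟨z, hzA, hzr, hz⟩ : ∃ z ∈ A, dist z x ≤ r ∧ ∀ w ∈ P, 4 * s < dist z w := by
      by_contra! hcon
      refine hlt.not_ge ?_
      have hsub : Metric.closedBall x r ⊆ (⋃ z ∈ P, Metric.closedBall z (4 * s)) ∪ Aᶜ := by
        intro z hz
        by_cases hzA : z ∈ A
        · obtain ⟨w, hw, hzw⟩ := hcon z hzA hz
          exact Or.inl (Set.mem_biUnion hw hzw)
        · exact Or.inr hzA
      refine (measureReal_mono hsub).trans ((measureReal_union_le _ _).trans ?_)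
      simp [measureReal_def, h.supp_null]
    have hzP : z ∉ P := fun hzP => by
      have := hz z hzP
      rw [dist_self] at this
      linarith
    refine ⟨insert z P, by rw [Finset.card_insert_of_notMem hzP, hPc], ?_, ?_⟩
    · intro w hw
      rcases Finset.mem_insert.1 hw with rfl | hw
      · exact ⟨hzA, hzr⟩
      · exact hPA w hw
    · intro v hv w hw hvw
      rcases Finset.mem_insert.1 hv with rfl | hv' <;>
        rcases Finset.mem_insert.1 hw with rfl | hw'
      · exact absurd rfl hvw
      · exact hz w hw'
      · rw [dist_comm]; exact hz v hv'
      · exact hPs v hv' w hw' hvw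

end IsHomog

lemma EquivNearZero.exists_abs_log_sub_le {X : Type*} [MetricSpace X] [MeasurableSpace X]
    {μ : Measure X} {x : X} {g : ℝ → ℝ} (h : EquivNearZero g (fun r => alphaPt μ x r)) :
    ∃ C : ℝ, 0 < C ∧ ∃ δ : ℝ, 0 < δ ∧ ∀ r : ℝ, 0 < r → r < δ →
      |Real.log (μ.real (Metric.closedBall x r)) - g r * Real.log r| ≤ C := by
  obtain ⟨C, hC, δ, hδ, H⟩ := h
  refine ⟨C, hC, min δ 1, lt_min hδ one_pos, fun r hr hrδ => ?_⟩
  have hlog : Real.log r < 0 := Real.log_neg hr (hrδ.trans_le (min_le_right _ _))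
  have h1 := H r hr (hrδ.trans_le (min_le_left _ _))
  rw [le_div_iff₀ (abs_pos.2 hlog.ne), ← abs_mul, sub_mul] at h1
  simpa [alphaPt, measureReal_def, div_mul_cancel₀ _ hlog.ne] using h1

/-- The ratio condition makes the measure on `B` grow faster than the measure on `A`, by any
prescribed factor, between radii with a suitable fixed ratio. -/
lemma exists_ratio_mul_le {X Y : Type*} [MetricSpace X] [MeasurableSpace X] [BorelSpace X]
    [MetricSpace Y] [MeasurableSpace Y] [BorelSpace Y]
    {A : Set X} {B : Set Y} {μ : Measure X} {ν : Measure Y}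
    {lamA kapA delA DelA lamB kapB delB DelB : ℝ}
    (hA : IsHomog A μ lamA kapA delA DelA) (hB : IsHomog B ν lamB kapB delB DelB)
    {gA gB : ℝ → ℝ} {x₀ : X} (hx₀ : x₀ ∈ A) {y₀ : Y} (hy₀ : y₀ ∈ B)
    (hgA : EquivNearZero gA (fun r => alphaPt μ x₀ r))
    (hgB : EquivNearZero gB (fun r => alphaPt ν y₀ r))
    {r₀ b : ℝ} (hr₀ : 0 < r₀) (hb : b < 1)
    (hsup : ∀ r r' : ℝ, 0 < r' → r' < r₀ * r → r < r₀ →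
      |(gA r * Real.log r - gA r' * Real.log r') /
        (gB r * Real.log r - gB r' * Real.log r')| ≤ b)
    {D : ℝ} (hD : 0 < D) {K : ℝ} (hK : 0 < K) :
    ∃ ρ : ℝ, 0 < ρ ∧ ρ ≤ 1 / 4 ∧ ∀ r : ℝ, 0 < r → r ≤ D →
      K * μ.real (Metric.closedBall x₀ r) * ν.real (Metric.closedBall y₀ (ρ * r)) ≤
        ν.real (Metric.closedBall y₀ r) * μ.real (Metric.closedBall x₀ (ρ * r)) := by
  obtain ⟨C₁, hC₁, δ₁, hδ₁, H₁⟩ := hgA.exists_abs_log_sub_le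
  obtain ⟨C₂, hC₂, δ₂, hδ₂, H₂⟩ := hgB.exists_abs_log_sub_le
  set F : ℝ → ℝ := fun r => Real.log (μ.real (Metric.closedBall x₀ r)) with hF
  set G : ℝ → ℝ := fun r => Real.log (ν.real (Metric.closedBall y₀ r)) with hG
  have hb0 : 0 ≤ b := (abs_nonneg _).trans
    (hsup (r₀ / 2) (r₀ * (r₀ / 2) / 2) (by positivity) (half_lt_self (by positivity)) (by linarith))
  -- the comparison at small scales
  have small : ∀ r r' : ℝ, 0 < r' → r' < r₀ * r → r' ≤ r → r < r₀ → r < δ₁ → r < δ₂ →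
      2 * C₂ + 1 ≤ G r - G r' → F r - F r' ≤ b * (G r - G r') + (2 * C₁ + 2 * C₂) := by
    intro r r' hr' hrr hle h0 h1 h2 hg
    have hr : 0 < r := hr'.trans_le hle
    have a1 := abs_le.1 (H₁ r hr h1)
    have a2 := abs_le.1 (H₁ r' hr' (hle.trans_lt h1))
    have a3 := abs_le.1 (H₂ r hr h2)
    have a4 := abs_le.1 (H₂ r' hr' (hle.trans_lt h2))
    have hq := hsup r r' hr' hrr h0
    have hpos : 0 < gB r * Real.log r - gB r' * Real.log r' := by
      simp only [hG] at hg
      linarith [a3.1, a3.2, a4.1, a4.2]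
    rw [abs_div, abs_of_pos hpos, div_le_iff₀ hpos] at hq
    have hq' := (le_abs_self _).trans hq
    have hbb : b * (gB r * Real.log r - gB r' * Real.log r') ≤ b * (G r - G r' + 2 * C₂) := by
      refine mul_le_mul_of_nonneg_left ?_ hb0
      simp only [hG]
      linarith [a3.1, a3.2, a4.1, a4.2]
    have hbc : b * C₂ ≤ C₂ := by nlinarith
    simp only [hF]
    linarith [a1.1, a1.2, a2.1, a2.2]
  set R : ℝ := min (min r₀ D) (min δ₁ δ₂) / 2 with hR
  have hmin : 0 < min (min r₀ D) (min δ₁ δ₂) := lt_min (lt_min hr₀ hD) (lt_min hδ₁ hδ₂)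
  have hRpos : 0 < R := half_pos hmin
  have hRlt : R < min (min r₀ D) (min δ₁ δ₂) := half_lt_self hmin
  obtain ⟨⟨hRr, hRD⟩, hRδ₁, hRδ₂⟩ : (R < r₀ ∧ R < D) ∧ R < δ₁ ∧ R < δ₂ := by
    simpa only [lt_min_iff] using hRlt
  have hFR : F R ≤ 0 := Real.log_nonpos measureReal_nonneg (hA.real_closedBall_le_one _ _)
  set T : ℝ := max (2 * C₂ + 1) ((2 * C₁ + 2 * C₂ - F R + Real.log K) / (1 - b)) with hT
  obtain ⟨ρ₀, hρ₀, Hρ⟩ := hB.exists_log_sub_log_ge hy₀ hD T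
  -- `ρ` is small enough to jump from `D` to well below `R`
  set ρ : ℝ := min (min ρ₀ (r₀ / 2)) (1 / 4) * (R / D) with hρdef
  have hm : 0 < min (min ρ₀ (r₀ / 2)) (1 / 4 : ℝ) :=
    lt_min (lt_min hρ₀ (by positivity)) (by norm_num)
  set m : ℝ := min (min ρ₀ (r₀ / 2)) (1 / 4 : ℝ) with hmdef
  have hmρ : m ≤ ρ₀ := (min_le_left _ _).trans (min_le_left _ _)
  have hmr : m ≤ r₀ / 2 := (min_le_left _ _).trans (min_le_right _ _)
  have hm4 : m ≤ 1 / 4 := min_le_right _ _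
  have hρ : 0 < ρ := by positivity
  have hρm : ρ ≤ m := by
    have : R / D ≤ 1 := (div_le_one hD).2 hRD.le
    nlinarith
  refine ⟨ρ, hρ, hρm.trans hm4, fun r hr hrD => ?_⟩
  have hρr : 0 < ρ * r := by positivity
  have hGT := Hρ ρ hρ (hρm.trans hmρ) r hr hrD
  have key : F r - F (ρ * r) ≤ b * (G r - G (ρ * r)) + (2 * C₁ + 2 * C₂ - F R) := by
    rcases le_total r R with hrR | hrR
    · have := small r (ρ * r) hρr (by nlinarith) (by nlinarith) (by linarith) (by linarith)
        (by linarith) ((le_max_left _ _).trans hGT)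
      linarith
    · have hρR : ρ * r ≤ m * R := by
        calc ρ * r ≤ ρ * D := by gcongr
          _ = m * R := by rw [hρdef]; field_simp
      have e : ρ * r / R * R = ρ * r := by field_simp
      have hGT' := Hρ (ρ * r / R) (by positivity)
        ((div_le_iff₀ hRpos).2 (hρR.trans (by gcongr))) R hRpos hRD.le
      rw [e] at hGT'
      have := small R (ρ * r) hρr (by nlinarith) (by nlinarith) hRr hRδ₁ hRδ₂
        ((le_max_left _ _).trans hGT')
      have hFr : F r ≤ 0 := Real.log_nonpos measureReal_nonneg (hA.real_closedBall_le_one _ _)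
      have hGr : G R ≤ G r := Real.log_le_log (hB.real_closedBall_pos hy₀ hRpos)
        (hB.real_closedBall_mono _ hrR)
      nlinarith
  have hT' : 2 * C₁ + 2 * C₂ - F R + Real.log K ≤ (G r - G (ρ * r)) * (1 - b) :=
    (div_le_iff₀ (by linarith)).1 ((le_max_right _ _).trans hGT)
  have p1 := hA.real_closedBall_pos hx₀ hr
  have p2 := hA.real_closedBall_pos hx₀ hρr
  have p3 := hB.real_closedBall_pos hy₀ hr
  have p4 := hB.real_closedBall_pos hy₀ hρr
  rw [← Real.log_le_log_iff (by positivity) (by positivity),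
    Real.log_mul (by positivity) p4.ne', Real.log_mul hK.ne' p1.ne', Real.log_mul p3.ne' p2.ne']
  simp only [hF, hG] at key hT'
  linarith

/-- Two points of `A` are related if they are joined by a chain in `A` with steps at most `r`. -/
def chainSetoid {X : Type*} [MetricSpace X] (A : Set X) (r : ℝ) : Setoid A :=
  Relation.EqvGen.setoid fun x y => dist x y ≤ r

section chainSetoid

variable {X : Type*} [MetricSpace X] {A : Set X}

lemma chainSetoid_of_dist_le {r : ℝ} {x y : A} (h : dist x y ≤ r) : chainSetoid A r x y :=
  Relation.EqvGen.rel _ _ h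

lemma chainSetoid_mono {r s : ℝ} (hrs : r ≤ s) {x y : A} (h : chainSetoid A r x y) :
    chainSetoid A s x y :=
  Relation.EqvGen.mono (fun _ _ hab => le_trans hab hrs) _ _ h

lemma chainSetoid_mem_iff {r : ℝ} (hr : 0 < r) {E : Set X}
    (hE : ENNReal.ofReal r < setDistE E (A \ E)) {x y : A} (h : chainSetoid A r x y) :
    (x : X) ∈ E ↔ (y : X) ∈ E := by
  have far : ∀ a b : A, (a : X) ∈ E → (b : X) ∉ E → r < dist a b := by
    intro a b ha hb
    have h1 : setDistE E (A \ E) ≤ edist (a : X) b :=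
      iInf₂_le_of_le (a : X) ha (iInf₂_le (b : X) ⟨b.2, hb⟩)
    have h2 := hE.trans_le h1
    rw [edist_dist] at h2
    exact (ENNReal.ofReal_lt_ofReal_iff_of_nonneg hr.le).1 h2
  induction h with
  | rel a b hab =>
    constructor
    · intro ha
      by_contra hb
      exact (far a b ha hb).not_ge hab
    · intro hb
      by_contra ha
      have := far b a hb ha
      rw [dist_comm] at this
      exact this.not_ge hab
  | refl a => exact Iff.rfl
  | symm a b _ ih => exact ih.symm
  | trans a b c _ _ ih₁ ih₂ => exact ih₁.trans ih₂

lemma UnifDisconn.exists_dist_le (h : UnifDisconn A) (hA : Bornology.IsBounded A) :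
    ∃ C : ℝ, 0 < C ∧ ∀ r : ℝ, 0 < r → ∀ x y : A, chainSetoid A r x y → dist x y ≤ C * r := by
  obtain ⟨C, hC, rs, hrs, H⟩ := h
  refine ⟨max C (Metric.diam A / rs), lt_max_of_lt_left (by linarith), fun r hr x y hxy => ?_⟩
  rcases lt_or_ge r rs with hlt | hge
  · obtain ⟨E, -, hball, hEC, hE⟩ := H x x.2 r hr hlt
    have hx : (x : X) ∈ E := hball ⟨x.2, Metric.mem_closedBall_self hr.le⟩
    have hy := hEC ((chainSetoid_mem_iff hr hE hxy).1 hx)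
    rw [Metric.mem_closedBall, dist_comm] at hy
    refine le_trans hy ?_
    gcongr
    exact le_max_left _ _
  · calc dist x y ≤ Metric.diam A := Metric.dist_le_diam_of_mem hA x.2 y.2
      _ = Metric.diam A / rs * rs := by field_simp
      _ ≤ max C (Metric.diam A / rs) * r := by
        gcongr
        exact le_max_right _ _

end chainSetoid

/-- If `c` meets at most `P.card` classes of the setoid `T`, those classes can be labelled by
distinct elements of `P`. -/
lemma exists_class_labelling {α β : Type*} (T : Setoid α) (c : Set α) (P : Finset β)
    (y : β) (hc : ∀ t : Finset α, (∀ a ∈ t, a ∈ c) →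
      (∀ a ∈ t, ∀ a' ∈ t, a ≠ a' → ¬ T a a') → t.card ≤ P.card) :
    ∃ h : α → β, (∀ a ∈ c, h a ∈ P) ∧ (∀ a a', T a a' → h a = h a') ∧
      ∀ a ∈ c, ∀ a' ∈ c, h a = h a' → T a a' := by
  classical
  set Q : Set (Quotient T) := Quotient.mk T '' c with hQ
  have hcard : ∀ u : Finset (Quotient T), (u : Set (Quotient T)) ⊆ Q → u.card ≤ P.card := by
    intro u hu
    rcases u.eq_empty_or_nonempty with rfl | ⟨q₀, hq₀⟩
    · simp
    have : Nonempty α := ⟨(hu hq₀).choose⟩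
    choose! f hf using fun q (hq : q ∈ u) => hu hq
    have hinj : Set.InjOn f u := fun q hq q' hq' e => by
      rw [← (hf q hq).2, ← (hf q' hq').2, e]
    rw [← Finset.card_image_of_injOn hinj]
    refine hc _ ?_ ?_
    · intro a ha
      obtain ⟨q, hq, rfl⟩ := Finset.mem_image.1 ha
      exact (hf q hq).1
    · intro a ha a' ha' hne hT
      obtain ⟨q, hq, rfl⟩ := Finset.mem_image.1 ha
      obtain ⟨q', hq', rfl⟩ := Finset.mem_image.1 ha'
      refine hne (congrArg f ?_)
      rw [← (hf q hq).2, ← (hf q' hq').2]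
      exact Quotient.sound hT
  have hfin : Q.Finite := by
    by_contra hinf
    obtain ⟨u, hu, hcu⟩ := Set.Infinite.exists_subset_card_eq hinf (P.card + 1)
    have := hcard u hu
    omega
  have hle : hfin.toFinset.card ≤ P.card := hcard _ (by simp)
  obtain ⟨P', hP', hP'c⟩ := Finset.exists_subset_card_eq hle
  let e := Finset.equivOfCardEq hP'c.symm
  refine ⟨fun a => if hq : Quotient.mk T a ∈ hfin.toFinset then (e ⟨_, hq⟩ : β) else y,
    ?_, ?_, ?_⟩
  · intro a ha
    have hq : Quotient.mk T a ∈ hfin.toFinset := hfin.mem_toFinset.2 (Set.mem_image_of_mem _ ha)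
    simp only [hq, dite_true]
    exact hP' (e _).2
  · intro a a' haa
    have : Quotient.mk T a = Quotient.mk T a' := Quotient.sound haa
    simp only [this]
  · intro a ha a' ha' heq
    have hq : Quotient.mk T a ∈ hfin.toFinset := hfin.mem_toFinset.2 (Set.mem_image_of_mem _ ha)
    have hq' : Quotient.mk T a' ∈ hfin.toFinset := hfin.mem_toFinset.2 (Set.mem_image_of_mem _ ha')
    simp only [hq, hq', dite_true] at heq
    have := e.injective (Subtype.ext heq)
    exact Quotient.exact (congrArg Subtype.val this)

/-- Refinement of a map constant on the classes of `S` to one constant on the classes of a finer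
setoid `T`, moving points by at most `r` and separating distinct classes of `T` by `s`. -/
lemma exists_refinement {α Y : Type*} [MetricSpace Y] {B : Set Y} (S T : Setoid α)
    (hTS : ∀ a a', T a a' → S a a') {r s : ℝ}
    (hP : ∀ a : α, ∀ y ∈ B, ∃ P : Finset Y, (∀ z ∈ P, z ∈ B ∧ dist z y ≤ r) ∧
      (∀ z ∈ P, ∀ w ∈ P, z ≠ w → s < dist z w) ∧
      ∀ t : Finset α, (∀ a' ∈ t, S a a') →
        (∀ a₁ ∈ t, ∀ a₂ ∈ t, a₁ ≠ a₂ → ¬ T a₁ a₂) → t.card ≤ P.card)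
    (f : α → Y) (hfB : ∀ a, f a ∈ B) (hf : ∀ a a', S a a' → f a = f a') :
    ∃ g : α → Y, (∀ a, g a ∈ B) ∧ (∀ a a', T a a' → g a = g a') ∧
      (∀ a, dist (g a) (f a) ≤ r) ∧ ∀ a a', S a a' → ¬ T a a' → s < dist (g a) (g a') := by
  have step : ∀ q : Quotient S, ∃ h : α → Y, (∀ a, Quotient.mk S a = q → h a ∈ B) ∧
      (∀ a, Quotient.mk S a = q → dist (h a) (f a) ≤ r) ∧
      (∀ a a', T a a' → h a = h a') ∧
      ∀ a a', Quotient.mk S a = q → Quotient.mk S a' = q → ¬ T a a' → s < dist (h a) (h a') := by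
    intro q
    obtain ⟨a₀, rfl⟩ := Quotient.exists_rep q
    obtain ⟨P, hPB, hPs, hPt⟩ := hP a₀ (f a₀) (hfB a₀)
    obtain ⟨h, h1, h2, h3⟩ := exists_class_labelling T {a | S a₀ a} P (f a₀) hPt
    have hmem : ∀ a, Quotient.mk S a = Quotient.mk S a₀ → S a₀ a := fun a ha =>
      S.symm (Quotient.exact ha)
    refine ⟨h, fun a ha => (hPB _ (h1 a (hmem a ha))).1, fun a ha => ?_, h2, ?_⟩
    · rw [← hf a₀ a (hmem a ha)]
      exact (hPB _ (h1 a (hmem a ha))).2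
    · intro a a' ha ha' hT
      exact hPs _ (h1 a (hmem a ha)) _ (h1 a' (hmem a' ha'))
        fun e => hT (h3 a (hmem a ha) a' (hmem a' ha') e)
  choose H H1 H2 H3 H4 using step
  refine ⟨fun a => H (Quotient.mk S a) a, fun a => H1 _ a rfl, ?_, fun a => H2 _ a rfl, ?_⟩
  · intro a a' hT
    have : Quotient.mk S a = Quotient.mk S a' := Quotient.sound (hTS a a' hT)
    simp only [this]
    exact H3 _ a a' hT
  · intro a a' hS hT
    have : Quotient.mk S a = Quotient.mk S a' := Quotient.sound hS
    simp only [this]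
    exact H4 _ a a' this rfl hT

/-- A set with a nested sequence of well-separated partitions embeds into a compact set all of
whose balls contain enough separated points at the next scale. -/
lemma bilipEmbed_of_refinements {X Y : Type*} [MetricSpace X] [MetricSpace Y] {A : Set X}
    {B : Set Y} (hB : IsCompact B) (hBne : B.Nonempty) (S : ℕ → Setoid A) {C D ρ : ℝ}
    (hD : 0 < D) (hρ : 0 < ρ) (hρ4 : ρ ≤ 1 / 4)
    (hS0 : ∀ a a', S 0 a a') (hS : ∀ k a a', S (k + 1) a a' → S k a a')
    (hSle : ∀ k a a', S k a a' → dist a a' ≤ C * (D * ρ ^ k))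
    (hSlt : ∀ k a a', ¬ S k a a' → D * ρ ^ k < dist a a')
    (hP : ∀ k, ∀ a : A, ∀ y ∈ B, ∃ P : Finset Y, (∀ z ∈ P, z ∈ B ∧ dist z y ≤ D * ρ ^ k) ∧
      (∀ z ∈ P, ∀ w ∈ P, z ≠ w → 4 * (D * ρ ^ (k + 1)) < dist z w) ∧
      ∀ t : Finset A, (∀ a' ∈ t, S k a a') →
        (∀ a₁ ∈ t, ∀ a₂ ∈ t, a₁ ≠ a₂ → ¬ S (k + 1) a₁ a₂) → t.card ≤ P.card) :
    BilipEmbed A B := by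
  classical
  obtain ⟨y₀, hy₀⟩ := hBne
  let Good (k : ℕ) (f : A → Y) : Prop := (∀ a, f a ∈ B) ∧ ∀ a a', S k a a' → f a = f a'
  have step : ∀ k (f : A → Y), Good k f → ∃ g : A → Y, Good (k + 1) g ∧
      (∀ a, dist (g a) (f a) ≤ D * ρ ^ k) ∧
      ∀ a a', S k a a' → ¬ S (k + 1) a a' → 4 * (D * ρ ^ (k + 1)) < dist (g a) (g a') := by
    intro k f hf
    obtain ⟨g, g1, g2, g3, g4⟩ :=
      exists_refinement (S k) (S (k + 1)) (hS k) (hP k) f hf.1 hf.2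
    exact ⟨g, ⟨g1, g2⟩, g3, g4⟩
  choose! next hnext using step
  let Φ : ℕ → A → Y := fun k => Nat.rec (fun _ => y₀) (fun k f => next k f) k
  have hgood : ∀ k, Good k (Φ k) := by
    intro k
    induction k with
    | zero => exact ⟨fun _ => hy₀, fun _ _ _ => rfl⟩
    | succ k ih => exact (hnext k _ ih).1
  have hstep : ∀ k a, dist (Φ (k + 1) a) (Φ k a) ≤ D * ρ ^ k :=
    fun k => (hnext k _ (hgood k)).2.1
  have hsep : ∀ k a a', S k a a' → ¬ S (k + 1) a a' →
      4 * (D * ρ ^ (k + 1)) < dist (Φ (k + 1) a) (Φ (k + 1) a') :=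
    fun k => (hnext k _ (hgood k)).2.2
  have hρ1 : ρ < 1 := by linarith
  have hstep' : ∀ a k, dist (Φ k a) (Φ (k + 1) a) ≤ D * ρ ^ k := fun a k => by
    rw [dist_comm]; exact hstep k a
  have hlim : ∀ a : A, ∃ y ∈ B, Tendsto (fun k => Φ k a) atTop (nhds y) := fun a =>
    cauchySeq_tendsto_of_isComplete hB.isComplete (fun k => (hgood k).1 a)
      (cauchySeq_of_le_geometric ρ D hρ1 (hstep' a))
  choose f hfB hflim using hlim
  have hclose : ∀ k a, dist (Φ k a) (f a) ≤ 3 / 2 * (D * ρ ^ k) := fun k a => by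
    refine (dist_le_of_le_geometric_of_tendsto ρ D hρ1 (hstep' a) (hflim a) k).trans ?_
    rw [div_le_iff₀ (by linarith)]
    have : 0 < D * ρ ^ k := by positivity
    nlinarith
  set L : ℝ := max 1 (max (C / ρ) (3 / ρ)) with hL
  have hL1 : 1 ≤ L := le_max_left _ _
  have hLC : C ≤ L * ρ := (div_le_iff₀ hρ).1 ((le_max_left _ _).trans (le_max_right _ _))
  have hL3 : 3 ≤ L * ρ := (div_le_iff₀ hρ).1 ((le_max_right _ _).trans (le_max_right _ _))
  have hbil : ∀ a a' : A, dist a a' / L ≤ dist (f a) (f a') ∧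
      dist (f a) (f a') ≤ L * dist a a' := by
    intro a a'
    rcases eq_or_ne a a' with rfl | hne
    · simp
    have hex : ∃ k, ¬ S k a a' := by
      by_contra! hall
      have ht : Tendsto (fun k => C * (D * ρ ^ k)) atTop (nhds 0) := by
        simpa using ((tendsto_pow_atTop_nhds_zero_of_lt_one hρ.le hρ1).const_mul D).const_mul C
      exact (dist_pos.2 hne).not_ge
        (ge_of_tendsto ht (Eventually.of_forall fun k => hSle k a a' (hall k)))
    obtain ⟨k, hk, hk'⟩ : ∃ k, S k a a' ∧ ¬ S (k + 1) a a' := by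
      by_contra! hcon
      obtain ⟨k, hk⟩ := hex
      exact hk (Nat.rec (hS0 a a') (fun n ih => hcon n ih) k)
    have hup := hSle k a a' hk
    have hlo := hSlt (k + 1) a a' hk'
    have hs := hsep k a a' hk hk'
    have c1 := hclose k a
    have c2 := hclose k a'
    have d1 := hclose (k + 1) a
    have d2 := hclose (k + 1) a'
    rw [← (hgood k).2 a a' hk] at c2
    have t1 := dist_triangle_left (f a) (f a') (Φ k a)
    have t2 := dist_triangle4 (Φ (k + 1) a) (f a) (f a') (Φ (k + 1) a')
    rw [dist_comm (f a') (Φ (k + 1) a')] at t2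
    have hpow : D * ρ ^ (k + 1) = ρ * (D * ρ ^ k) := by ring
    rw [hpow] at hlo hs d1 d2
    have hx : 0 < D * ρ ^ k := by positivity
    set x := D * ρ ^ k
    have hLpos : 0 < L := by linarith
    constructor
    · rw [div_le_iff₀ hLpos]
      have h1 : ρ * x ≤ dist (f a) (f a') := by linarith
      calc dist a a' ≤ C * x := hup
        _ ≤ L * ρ * x := by gcongr
        _ = ρ * x * L := by ring
        _ ≤ _ := by gcongr
    · calc dist (f a) (f a') ≤ 3 * x := by linarith
        _ ≤ L * ρ * x := by gcongr
        _ = L * (ρ * x) := by ring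
        _ ≤ _ := by gcongr
  refine ⟨fun x => if hx : x ∈ A then f ⟨x, hx⟩ else y₀, L, hL1, ?_, ?_, ?_⟩
  · intro x hx
    simpa [hx] using hfB ⟨x, hx⟩
  · intro x hx x' hx' heq
    simp only [hx, hx', dite_true] at heq
    have h1 := (hbil ⟨x, hx⟩ ⟨x', hx'⟩).1
    rw [heq, dist_self, div_le_iff₀ (by linarith), zero_mul] at h1
    exact congrArg Subtype.val (dist_le_zero.1 h1)
  · intro x hx x' hx'
    simp only [hx, hx', dite_true]
    exact hbil ⟨x, hx⟩ ⟨x', hx'⟩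

/-- Embedding theorem, second part: if moreover `A` is uniformly disconnected and
`sup_{r' < r₀ r < r < r₀} |(α_A(r)log r − α_A(r')log r')/(α_B(r)log r − α_B(r')log r')| < 1`
for some `r₀ < 1`, then `A` can be bilipschitz embedded into `B`. -/
theorem statement15 {X Y : Type*} [MetricSpace X] [MeasurableSpace X] [BorelSpace X]
    [MetricSpace Y] [MeasurableSpace Y] [BorelSpace Y]
    (A : Set X) (B : Set Y) (μ : Measure X) (ν : Measure Y)
    (lamA kapA delA DelA lamB kapB delB DelB : ℝ)
    (hA : IsHomog A μ lamA kapA delA DelA) (hB : IsHomog B ν lamB kapB delB DelB)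
    (gA gB : ℝ → ℝ) (hgA : IsAlphaRep A μ gA) (hgB : IsAlphaRep B ν gB)
    (hsup : ∃ r₀ : ℝ, 0 < r₀ ∧ r₀ < 1 ∧ ∃ b : ℝ, b < 1 ∧
      ∀ r r' : ℝ, 0 < r' → r' < r₀ * r → r < r₀ →
        |(gA r * Real.log r - gA r' * Real.log r') /
          (gB r * Real.log r - gB r' * Real.log r')| ≤ b)
    (hud : UnifDisconn A) :
    BilipEmbed A B := by
  classical
  obtain ⟨x₀, hx₀, hgA⟩ := hgA
  obtain ⟨y₀, hy₀, hgB⟩ := hgB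
  obtain ⟨r₀, hr₀, -, b, hb, hsup⟩ := hsup
  obtain ⟨C, hC, hCdist⟩ := hud.exists_dist_le hA.compact.isBounded
  obtain ⟨K₁, hK₁, hcard⟩ := hA.exists_card_mul_le hx₀ hC
  obtain ⟨K₂, hK₂, hsepB⟩ := hB.exists_separated hy₀
  have hD := hA.diam_pos
  obtain ⟨ρ, hρ, hρ4, hratio⟩ := exists_ratio_mul_le hA hB hx₀ hy₀ hgA hgB hr₀ hb hsup hD
    (mul_pos hK₁ hK₂)
  set D := Metric.diam A
  have hρ1 : ρ ≤ 1 := by linarith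
  refine bilipEmbed_of_refinements (C := C) hB.compact ⟨y₀, hy₀⟩ (fun k => chainSetoid A (D * ρ ^ k))
    hD hρ hρ4 ?_ ?_ ?_ ?_ ?_
  · intro a a'
    refine chainSetoid_of_dist_le ?_
    rw [pow_zero, mul_one]
    exact Metric.dist_le_diam_of_mem hA.compact.isBounded a.2 a'.2
  · intro k a a'
    refine chainSetoid_mono ?_
    exact mul_le_mul_of_nonneg_left (pow_le_pow_of_le_one hρ.le hρ1 k.le_succ) hD.le
  · exact fun k a a' => hCdist _ (by positivity) a a'
  · intro k a a' h
    by_contra! hle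
    exact h (chainSetoid_of_dist_le hle)
  · intro k a y hy
    have hr : 0 < D * ρ ^ k := by positivity
    have hpow : D * ρ ^ (k + 1) = ρ * (D * ρ ^ k) := by ring
    have hrat := hratio (D * ρ ^ k) hr
      (mul_le_of_le_one_right hD.le (pow_le_one₀ hρ.le hρ1))
    rw [hpow]
    set r := D * ρ ^ k
    have hs : 0 < ρ * r := by positivity
    have pA := hA.real_closedBall_pos hx₀ hs
    have pB := hB.real_closedBall_pos hy₀ hs
    set N : ℝ := K₁ * μ.real (Metric.closedBall x₀ r) / μ.real (Metric.closedBall x₀ (ρ * r))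
      with hN
    have hN0 : 0 ≤ N := by positivity
    obtain ⟨P, hPc, hPB, hPs⟩ := hsepB y hy r (ρ * r) hr hs ⌊N⌋₊ (by
      calc (⌊N⌋₊ : ℝ) * (K₂ * ν.real (Metric.closedBall y₀ (ρ * r)))
          ≤ N * (K₂ * ν.real (Metric.closedBall y₀ (ρ * r))) := by
            gcongr
            exact Nat.floor_le hN0
        _ = K₁ * K₂ * μ.real (Metric.closedBall x₀ r) *
              ν.real (Metric.closedBall y₀ (ρ * r)) / μ.real (Metric.closedBall x₀ (ρ * r)) := by
            rw [hN]; ring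
        _ ≤ _ := (div_le_iff₀ pA).2 hrat)
    refine ⟨P, hPB, hPs, fun t htS htT => ?_⟩
    rw [hPc]
    refine Nat.le_floor ?_
    rw [hN, le_div_iff₀ pA, ← Finset.card_map (Function.Embedding.subtype _)]
    refine hcard a a.2 r (ρ * r) hs (by nlinarith) _ ?_ ?_
    · intro z hz
      obtain ⟨z', hz', rfl⟩ := Finset.mem_map.1 hz
      refine ⟨z'.2, ?_⟩
      rw [dist_comm]
      exact hCdist r hr a z' (htS z' hz')
    · intro z hz w hw hzw
      obtain ⟨z', hz', rfl⟩ := Finset.mem_map.1 hz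
      obtain ⟨w', hw', rfl⟩ := Finset.mem_map.1 hw
      by_contra! hle
      refine htT z' hz' w' hw' (fun e => hzw (by rw [e])) ?_
      exact chainSetoid_of_dist_le hle

end
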